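/- arXiv:2601.13214 — 2 statements merged into one kernel-verified Lean document; each statement's English description precedes it below -/
import Mathlib

section
/- Fix δ > 0, ρ > 0 and λ > 0. The function f(a) := δρ(τ_a² − 1) + δρ²τ_a²/γ_a² + λa², defined for a ∈ [0,∞), is strongly convex and continuously differentiable on [0,∞). -/
noncomputable section
open MeasureTheory ProbabilityTheory Filter
open scoped ENNReal NNReal

/-- The standard real Gaussian measure `N(0,1)`. -/
def stdGaussian : Measure ℝ := gaussianReal 0 1

/-- The denoiser `η_a(x; γ) = P_{[-a,a]}(x/(1+γ))`. -/
def eta (a γ x : ℝ) : ℝ := max (-a) (min a (x / (1 + γ)))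

/-- The derivative of the denoiser in `x` (defined except at `|x| = a(1+γ)`). -/
def eta' (a γ x : ℝ) : ℝ := if |x| < a * (1 + γ) then 1 / (1 + γ) else 0

/-- `(τ², γ)` solves the state-evolution fixed-point equations for parameters `(δ, ρ, a)`:
`τ² = 1 + δ⁻¹ E[η_a(τZ; γ)²]` and `ρ = γ (1 − δ⁻¹ E[η_a'(τZ; γ)])`, with `τ² ≥ 1, γ > 0`. -/
def IsSEFixedPoint (δ ρ a : ℝ) (p : ℝ × ℝ) : Prop :=
  1 ≤ p.1 ∧ 0 < p.2 ∧
    p.1 = 1 + δ⁻¹ * ∫ z, (eta a p.2 (Real.sqrt p.1 * z)) ^ 2 ∂stdGaussian ∧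
    ρ = p.2 * (1 - δ⁻¹ * ∫ z, eta' a p.2 (Real.sqrt p.1 * z) ∂stdGaussian)

/-- The limiting objective `f(a) = δρ(τ_a² − 1) + δρ²τ_a²/γ_a² + λa²`, expressed in terms of
functions `a ↦ τ_a²` and `a ↦ γ_a`. -/
def fLim (δ ρ lam : ℝ) (τ2 γv : ℝ → ℝ) (a : ℝ) : ℝ :=
  δ * ρ * (τ2 a - 1) + δ * ρ ^ 2 * τ2 a / (γv a) ^ 2 + lam * a ^ 2

open Topology in
/-- **Stein's identity** for a bounded continuous function differentiable off a countable set. -/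
lemma integral_id_mul_gaussianReal_eq_integral_deriv {f f' : ℝ → ℝ} {s : Set ℝ} {C : ℝ}
    (hs : s.Countable) (hf : Continuous f) (hC : ∀ z, |f z| ≤ C)
    (hd : ∀ z, z ∉ s → HasDerivAt f (f' z) z)
    (hi : Integrable (fun z ↦ z * f z) (gaussianReal 0 1))
    (hi' : Integrable f' (gaussianReal 0 1)) :
    ∫ z, z * f z ∂gaussianReal 0 1 = ∫ z, f' z ∂gaussianReal 0 1 := by
  set φ : ℝ → ℝ := gaussianPDFReal 0 1 with hφdef
  have hφ : ∀ z, φ z = (√(2 * Real.pi))⁻¹ * Real.exp (-z ^ 2 / 2) := by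
    intro z
    simp [hφdef, gaussianPDFReal]
  have hφ' : ∀ z, HasDerivAt φ (-z * φ z) z := by
    intro z
    have h : HasDerivAt (fun z : ℝ ↦ -z ^ 2 / 2) (-z) z :=
      ((hasDerivAt_pow 2 z).fun_neg.div_const 2).congr_deriv (by norm_num; ring)
    have h2 := (h.exp).const_mul (√(2 * Real.pi))⁻¹
    have he : φ = fun z ↦ (√(2 * Real.pi))⁻¹ * Real.exp (-z ^ 2 / 2) := funext hφ
    rw [he]
    exact h2.congr_deriv (by ring)
  have hφc : Continuous φ := continuous_iff_continuousAt.2 fun z ↦ (hφ' z).continuousAt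
  have hφlim : ∀ l : Filter ℝ, Tendsto (fun z : ℝ ↦ z ^ 2) l atTop → Tendsto φ l (𝓝 0) := by
    intro l hl
    have h1 : Tendsto (fun z : ℝ ↦ -z ^ 2 / 2) l atBot :=
      (tendsto_neg_atTop_atBot.comp hl).atBot_div_const two_pos
    have h2 := (Real.tendsto_exp_atBot.comp h1).const_mul (√(2 * Real.pi))⁻¹
    rw [mul_zero] at h2
    exact h2.congr fun z ↦ (hφ z).symm
  have hFlim : ∀ l : Filter ℝ, Tendsto (fun z : ℝ ↦ z ^ 2) l atTop →
      Tendsto (fun z ↦ f z * φ z) l (𝓝 0) := by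
    intro l hl
    refine squeeze_zero_norm (a := fun z ↦ C * |φ z|) (fun z ↦ ?_) ?_
    · rw [norm_mul, Real.norm_eq_abs, Real.norm_eq_abs]
      exact mul_le_mul_of_nonneg_right (hC z) (abs_nonneg _)
    · simpa using ((hφlim l hl).abs).const_mul C
  have hsub : Integrable (fun z ↦ f' z - z * f z) (gaussianReal 0 1) := hi'.sub hi
  have hint : Integrable (fun z ↦ φ z * (f' z - z * f z)) := by
    rw [gaussianReal_of_var_ne_zero 0 one_ne_zero,
      integrable_withDensity_iff_integrable_smul' (measurable_gaussianPDF _ _)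
        (ae_of_all _ fun _ ↦ gaussianPDF_lt_top)] at hsub
    simpa [toReal_gaussianPDF] using hsub
  have hFTC : ∀ n : ℕ, ∫ z in (-(n : ℝ))..n, φ z * (f' z - z * f z)
      = f n * φ n - f (-n) * φ (-n) := by
    intro n
    refine integral_eq_of_hasDerivAt_off_countable (fun z ↦ f z * φ z) _ hs
      (hf.mul hφc).continuousOn (fun z hz ↦ ?_) hint.intervalIntegrable
    exact ((hd z hz.2).mul (hφ' z)).congr_deriv (by ring)
  have hn : Tendsto (fun n : ℕ ↦ (n : ℝ)) atTop atTop := tendsto_natCast_atTop_atTop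
  have hn' : Tendsto (fun n : ℕ ↦ -(n : ℝ)) atTop atBot := tendsto_neg_atTop_atBot.comp hn
  have hlim := intervalIntegral_tendsto_integral hint hn' hn
  have hzero : Tendsto (fun n : ℕ ↦ f n * φ n - f (-n) * φ (-n)) atTop (𝓝 0) := by
    have h1 := (hFlim atTop (tendsto_pow_atTop two_ne_zero)).comp hn
    have h2 := (hFlim atBot (by
      have := (tendsto_pow_atTop (α := ℝ) two_ne_zero).comp tendsto_neg_atBot_atTop
      exact this.congr fun z ↦ by simp)).comp hn'
    simpa using h1.sub h2
  have key := tendsto_nhds_unique (hlim.congr hFTC) hzero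
  have : ∫ z, (f' z - z * f z) ∂gaussianReal 0 1 = 0 := by
    rw [integral_gaussianReal_eq_integral_smul one_ne_zero]
    simpa using key
  rw [integral_sub hi' hi] at this
  linarith

/-- The projection of `y` onto `[-a, a]`. -/
def clip (a y : ℝ) : ℝ := max (-a) (min a y)

lemma continuous_clip : Continuous fun p : ℝ × ℝ ↦ clip p.1 p.2 := by
  unfold clip
  fun_prop

lemma abs_clip_le (a y : ℝ) : |clip a y| ≤ |a| := by
  unfold clip
  grind

lemma integrable_id_stdGaussian : Integrable (fun z : ℝ ↦ z) (gaussianReal 0 1) :=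
  memLp_one_iff_integrable.1 (memLp_id_gaussianReal 1)

lemma continuous_clip_mul (a k : ℝ) : Continuous fun z ↦ clip a (k * z) :=
  continuous_clip.comp (by fun_prop : Continuous fun z : ℝ ↦ (a, k * z))

lemma integrable_clip_sq (a k : ℝ) :
    Integrable (fun z ↦ clip a (k * z) ^ 2) (gaussianReal 0 1) := by
  refine (integrable_const (|a| ^ 2)).mono'
    ((continuous_clip_mul a k).pow 2).aestronglyMeasurable (ae_of_all _ fun z ↦ ?_)
  rw [Real.norm_eq_abs, abs_pow]
  exact pow_le_pow_left₀ (abs_nonneg _) (abs_clip_le _ _) 2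

lemma integrable_id_mul_clip (a k : ℝ) :
    Integrable (fun z ↦ z * clip a (k * z)) (gaussianReal 0 1) := by
  refine (integrable_id_stdGaussian.abs.mul_const |a|).mono'
    (continuous_id.mul (continuous_clip_mul a k)).aestronglyMeasurable (ae_of_all _ fun z ↦ ?_)
  rw [Real.norm_eq_abs, abs_mul]
  exact mul_le_mul_of_nonneg_left (abs_clip_le _ _) (abs_nonneg _)

lemma integrable_excess (s c : ℝ) :
    Integrable (fun z : ℝ ↦ max 0 (s * |z| - c)) (gaussianReal 0 1) :=
  (integrable_zero _ _ _).sup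
    ((integrable_id_stdGaussian.abs.const_mul s).sub (integrable_const c))

lemma integrable_ite_abs_lt (a k : ℝ) :
    Integrable (fun z : ℝ ↦ if |k * z| < a then k else 0) (gaussianReal 0 1) := by
  refine (integrable_const |k|).mono' ?_ (ae_of_all _ fun z ↦ ?_)
  · exact (Measurable.ite (measurableSet_lt (by fun_prop) (by fun_prop)) measurable_const
      measurable_const).aestronglyMeasurable
  · split_ifs <;> simp

open Topology in
lemma hasDerivAt_clip_mul {a k z : ℝ} (ha : 0 ≤ a) (h₁ : k * z ≠ a) (h₂ : k * z ≠ -a) :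
    HasDerivAt (fun z ↦ clip a (k * z)) (if |k * z| < a then k else 0) z := by
  have hc : ContinuousAt (fun z : ℝ ↦ k * z) z := by fun_prop
  rcases lt_or_gt_of_ne h₁ with h | h
  · rcases lt_or_gt_of_ne h₂ with h' | h'
    · rw [if_neg (by rw [abs_lt]; intro hh; linarith [hh.1])]
      refine (hasDerivAt_const z (-a)).congr_of_eventuallyEq ?_
      filter_upwards [hc.eventually_lt_const h'] with w hw
      unfold clip
      grind
    · rw [if_pos (abs_lt.2 ⟨h', h⟩)]
      have hid : HasDerivAt (fun z : ℝ ↦ k * z) k z := by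
        simpa using (hasDerivAt_id z).const_mul k
      refine hid.congr_of_eventuallyEq ?_
      filter_upwards [hc.eventually_lt_const h, hc.eventually_const_lt h'] with w hw hw'
      unfold clip
      grind
  · rw [if_neg (by rw [abs_lt]; intro hh; linarith [hh.2])]
    refine (hasDerivAt_const z a).congr_of_eventuallyEq ?_
    filter_upwards [hc.eventually_const_lt h] with w hw
    unfold clip
    grind

lemma integral_id_mul_clip {a k : ℝ} (ha : 0 ≤ a) (hk : 0 < k) :
    ∫ z, z * clip a (k * z) ∂gaussianReal 0 1
      = ∫ z, (if |k * z| < a then k else 0) ∂gaussianReal 0 1 := by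
  refine integral_id_mul_gaussianReal_eq_integral_deriv (s := {a / k, -a / k}) (C := |a|)
    (Set.toFinite _).countable (continuous_clip_mul a k) (fun z ↦ abs_clip_le _ _)
    (fun z hz ↦ hasDerivAt_clip_mul ha ?_ ?_) (integrable_id_mul_clip a k)
    (integrable_ite_abs_lt a k)
  · rintro rfl
    exact hz (by left; field_simp)
  · intro h
    exact hz (by right; rw [Set.mem_singleton_iff, ← h]; field_simp)

lemma continuous_integral_clip_sq :
    Continuous fun p : ℝ × ℝ ↦ ∫ z, clip p.1 (p.2 * z) ^ 2 ∂gaussianReal 0 1 := by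
  refine continuous_iff_continuousAt.2 fun p ↦ ?_
  refine continuousAt_of_dominated (bound := fun _ ↦ (|p.1| + 1) ^ 2)
    (Eventually.of_forall fun q ↦ (integrable_clip_sq q.1 q.2).1) ?_ (integrable_const _)
    (ae_of_all _ fun z ↦ ?_)
  · have hc : ContinuousAt (fun q : ℝ × ℝ ↦ |q.1|) p := by fun_prop
    filter_upwards [hc.eventually_lt_const (lt_add_one _)] with q hq
    refine ae_of_all _ fun z ↦ ?_
    rw [Real.norm_eq_abs, abs_pow]
    exact pow_le_pow_left₀ (abs_nonneg _) ((abs_clip_le _ _).trans hq.le) 2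
  · exact ((continuous_clip.comp
      (by fun_prop : Continuous fun q : ℝ × ℝ ↦ (q.1, q.2 * z))).pow 2).continuousAt

lemma continuous_integral_id_mul_clip :
    Continuous fun p : ℝ × ℝ ↦ ∫ z, z * clip p.1 (p.2 * z) ∂gaussianReal 0 1 := by
  refine continuous_iff_continuousAt.2 fun p ↦ ?_
  refine continuousAt_of_dominated (bound := fun z ↦ |z| * (|p.1| + 1))
    (Eventually.of_forall fun q ↦ (integrable_id_mul_clip q.1 q.2).1) ?_
    (integrable_id_stdGaussian.abs.mul_const _) (ae_of_all _ fun z ↦ ?_)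
  · have hc : ContinuousAt (fun q : ℝ × ℝ ↦ |q.1|) p := by fun_prop
    filter_upwards [hc.eventually_lt_const (lt_add_one _)] with q hq
    refine ae_of_all _ fun z ↦ ?_
    rw [Real.norm_eq_abs, abs_mul]
    exact mul_le_mul_of_nonneg_left ((abs_clip_le _ _).trans hq.le) (abs_nonneg _)
  · exact (continuous_const.mul (continuous_clip.comp
      (by fun_prop : Continuous fun q : ℝ × ℝ ↦ (q.1, q.2 * z)))).continuousAt

lemma continuous_integral_excess :
    Continuous fun p : ℝ × ℝ ↦ ∫ z, max 0 (p.1 * |z| - p.2) ∂gaussianReal 0 1 := by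
  refine continuous_iff_continuousAt.2 fun p ↦ ?_
  refine continuousAt_of_dominated (bound := fun z ↦ (|p.1| + 1) * |z| + (|p.2| + 1))
    (Eventually.of_forall fun q ↦ (integrable_excess q.1 q.2).1) ?_
    ((integrable_id_stdGaussian.abs.const_mul _).add (integrable_const _))
    (ae_of_all _ fun z ↦ by fun_prop)
  have hc₁ : ContinuousAt (fun q : ℝ × ℝ ↦ |q.1|) p := by fun_prop
  have hc₂ : ContinuousAt (fun q : ℝ × ℝ ↦ |q.2|) p := by fun_prop
  filter_upwards [hc₁.eventually_lt_const (lt_add_one _),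
    hc₂.eventually_lt_const (lt_add_one _)] with q hq₁ hq₂
  refine ae_of_all _ fun z ↦ ?_
  have h₁ : q.1 * |z| ≤ (|p.1| + 1) * |z| :=
    mul_le_mul_of_nonneg_right ((le_abs_self _).trans hq₁.le) (abs_nonneg _)
  have h₂ : -q.2 ≤ |p.2| + 1 := (neg_le_abs _).trans hq₂.le
  rw [Real.norm_eq_abs, abs_of_nonneg (le_max_left _ _)]
  exact max_le (by positivity) (by linarith)

/-- The fixed-point equations with Stein's identity applied to the second one. -/
lemma isSEFixedPoint_iff {δ ρ a : ℝ} (ha : 0 ≤ a) (p : ℝ × ℝ) :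
    IsSEFixedPoint δ ρ a p ↔ 1 ≤ p.1 ∧ 0 < p.2 ∧
      p.1 = 1 + δ⁻¹ * ∫ z, clip a (√p.1 / (1 + p.2) * z) ^ 2 ∂gaussianReal 0 1 ∧
      ρ = p.2 * (1 - δ⁻¹ *
        ((∫ z, z * clip a (√p.1 / (1 + p.2) * z) ∂gaussianReal 0 1) / √p.1)) := by
  obtain ⟨t, γ⟩ := p
  unfold IsSEFixedPoint
  refine and_congr_right fun ht ↦ and_congr_right fun hγ ↦ ?_
  dsimp only at ht hγ ⊢
  have hs : 0 < √t := Real.sqrt_pos.2 (by linarith)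
  have hγ1 : 0 < 1 + γ := by linarith
  have heta : ∀ z, eta a γ (√t * z) = clip a (√t / (1 + γ) * z) := by
    intro z
    rw [div_mul_eq_mul_div]
    rfl
  have heta' : ∀ z, eta' a γ (√t * z)
      = (if |√t / (1 + γ) * z| < a then √t / (1 + γ) else 0) / √t := by
    intro z
    have : |√t / (1 + γ) * z| < a ↔ |√t * z| < a * (1 + γ) := by
      rw [div_mul_eq_mul_div, abs_div, abs_of_pos hγ1, div_lt_iff₀ hγ1]
    simp only [eta', this]
    split_ifs
    · field_simp
    · simp
  simp only [heta, heta']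
  rw [integral_id_mul_clip ha (div_pos hs hγ1), integral_div]
  rfl

/-- The variational inequality for the projection onto `[-a, a]`, tested against a point of
`[-a', a']`. -/
lemma clip_variational {a a' γ w x : ℝ} (ha : 0 ≤ a) (hγ : 0 < 1 + γ) (hx : |x| ≤ a') :
    -((a' - a) * max 0 (|w| - a * (1 + γ)))
      ≤ (x - clip a (w / (1 + γ))) * ((1 + γ) * clip a (w / (1 + γ)) - w) := by
  obtain ⟨hx₁, hx₂⟩ := abs_le.1 hx
  have haγ : 0 ≤ a * (1 + γ) := by positivity
  rcases lt_or_ge a (w / (1 + γ)) with h | h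
  · have hc : clip a (w / (1 + γ)) = a := by unfold clip; grind
    rw [lt_div_iff₀ hγ] at h
    rw [hc, abs_of_nonneg (by linarith), max_eq_right (by linarith)]
    nlinarith
  · rcases lt_or_ge (w / (1 + γ)) (-a) with h' | h'
    · have hc : clip a (w / (1 + γ)) = -a := by unfold clip; grind
      rw [div_lt_iff₀ hγ] at h'
      rw [hc, abs_of_nonpos (by linarith), max_eq_right (by linarith)]
      nlinarith
    · have hc : clip a (w / (1 + γ)) = w / (1 + γ) := by unfold clip; grind
      rw [div_le_iff₀ hγ] at h
      rw [le_div_iff₀ hγ] at h'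
      rw [hc, max_eq_left (by linarith [abs_le.2 ⟨by linarith, h⟩]), mul_div_cancel₀ _ hγ.ne']
      simp

lemma integrand_lower_bound {ρ γ a a' s₁ s₂ z x : ℝ} (ha : 0 ≤ a) (hρ : 0 < ρ) (hγ : 0 < γ)
    (hs₁ : 0 < s₁) (hs₂ : 0 < s₂) (hx : |x| ≤ a') :
    (ρ / 2 + ρ / γ - ρ * s₂ / (2 * γ * s₁)) * clip a (s₁ / (1 + γ) * z) ^ 2
        - ρ * s₁ / γ * (z * clip a (s₁ / (1 + γ) * z))
        - (a' - a) * (ρ / γ) * max 0 (s₁ * |z| - a * (1 + γ))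
      ≤ (ρ * s₁ / (2 * γ * s₂) + ρ / 2) * x ^ 2 - ρ * s₁ / γ * (z * x) := by
  have hV := clip_variational (w := s₁ * z) ha (by linarith : 0 < 1 + γ) hx
  rw [abs_mul, abs_of_pos hs₁, mul_div_right_comm] at hV
  generalize clip a (s₁ / (1 + γ) * z) = y at hV ⊢
  have hV' := mul_le_mul_of_nonneg_left hV (div_pos hρ hγ).le
  have hsq : 0 ≤ ρ / (2 * γ * s₁ * s₂) * (s₁ * x - s₂ * y) ^ 2 + ρ / 2 * (x - y) ^ 2 := by
    positivity
  have hid : (ρ * s₁ / (2 * γ * s₂) + ρ / 2) * x ^ 2 - ρ * s₁ / γ * (z * x)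
      - ((ρ / 2 + ρ / γ - ρ * s₂ / (2 * γ * s₁)) * y ^ 2 - ρ * s₁ / γ * (z * y))
      = ρ / (2 * γ * s₁ * s₂) * (s₁ * x - s₂ * y) ^ 2 + ρ / 2 * (x - y) ^ 2
        + ρ / γ * ((x - y) * ((1 + γ) * y - s₁ * z)) := by
    field_simp
    ring
  linarith

/-- The slope of the subgradient of `a ↦ δρ(τ_a² − 1) + δρ²τ_a²/γ_a²`. -/
def seSlope (ρ a : ℝ) (p : ℝ × ℝ) : ℝ :=
  -(2 * (ρ / p.2) * ∫ z, max 0 (√p.1 * |z| - a * (1 + p.2)) ∂gaussianReal 0 1)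

/-- The value `δρ(τ² − 1) + δρ²τ²/γ²`. -/
def seValue (δ ρ : ℝ) (p : ℝ × ℝ) : ℝ :=
  δ * ρ * (p.1 - 1) + δ * ρ ^ 2 * p.1 / p.2 ^ 2

lemma seValue_add_slope_le {δ ρ a a' : ℝ} (hδ : 0 < δ) (hρ : 0 < ρ) (ha : 0 ≤ a) (ha' : 0 ≤ a')
    {p p' : ℝ × ℝ} (hp : IsSEFixedPoint δ ρ a p) (hp' : IsSEFixedPoint δ ρ a' p') :
    seValue δ ρ p + seSlope ρ a p * (a' - a) ≤ seValue δ ρ p' := by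
  obtain ⟨t₁, γ₁⟩ := p
  obtain ⟨t₂, γ₂⟩ := p'
  obtain ⟨ht₁, hγ₁, hA₁, hB₁⟩ := (isSEFixedPoint_iff ha _).1 hp
  obtain ⟨ht₂, hγ₂, hA₂, hB₂⟩ := (isSEFixedPoint_iff ha' _).1 hp'
  unfold seValue seSlope
  dsimp only at *
  have hs₁ : 0 < √t₁ := Real.sqrt_pos.2 (by linarith)
  have hs₂ : 0 < √t₂ := Real.sqrt_pos.2 (by linarith)
  have hsq₁ : √t₁ ^ 2 = t₁ := Real.sq_sqrt (by linarith)
  have hsq₂ : √t₂ ^ 2 = t₂ := Real.sq_sqrt (by linarith)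
  set s₁ := √t₁
  set s₂ := √t₂
  have hI := integral_mono (μ := gaussianReal 0 1)
    ((((integrable_clip_sq a (s₁ / (1 + γ₁))).const_mul
          (ρ / 2 + ρ / γ₁ - ρ * s₂ / (2 * γ₁ * s₁))).sub
        ((integrable_id_mul_clip a (s₁ / (1 + γ₁))).const_mul (ρ * s₁ / γ₁))).sub
        ((integrable_excess s₁ (a * (1 + γ₁))).const_mul ((a' - a) * (ρ / γ₁))))
    (((integrable_clip_sq a' (s₂ / (1 + γ₂))).const_mul
          (ρ * s₁ / (2 * γ₁ * s₂) + ρ / 2)).sub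
        ((integrable_id_mul_clip a' (s₂ / (1 + γ₂))).const_mul (ρ * s₁ / γ₁)))
    (fun z ↦ integrand_lower_bound (z := z) ha hρ hγ₁ hs₁ hs₂
      ((abs_clip_le _ _).trans (abs_of_nonneg ha').le))
  simp only [Pi.sub_apply] at hI
  rw [integral_sub (by
      exact ((integrable_clip_sq a (s₁ / (1 + γ₁))).const_mul _).sub
        ((integrable_id_mul_clip a (s₁ / (1 + γ₁))).const_mul _))
      ((integrable_excess s₁ (a * (1 + γ₁))).const_mul _),
    integral_sub ((integrable_clip_sq a (s₁ / (1 + γ₁))).const_mul _)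
      ((integrable_id_mul_clip a (s₁ / (1 + γ₁))).const_mul _),
    integral_sub ((integrable_clip_sq a' (s₂ / (1 + γ₂))).const_mul _)
      ((integrable_id_mul_clip a' (s₂ / (1 + γ₂))).const_mul _)] at hI
  simp only [integral_const_mul] at hI
  generalize (∫ z, clip a (s₁ / (1 + γ₁) * z) ^ 2 ∂gaussianReal 0 1) = A₁ at *
  generalize (∫ z, clip a' (s₂ / (1 + γ₂) * z) ^ 2 ∂gaussianReal 0 1) = A₂ at *
  generalize (∫ z, z * clip a (s₁ / (1 + γ₁) * z) ∂gaussianReal 0 1) = B₁ at *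
  generalize (∫ z, z * clip a' (s₂ / (1 + γ₂) * z) ∂gaussianReal 0 1) = B₂ at *
  generalize (∫ z, max 0 (s₁ * |z| - a * (1 + γ₁)) ∂gaussianReal 0 1) = E₁ at *
  have hA₁' : A₁ = δ * (s₁ ^ 2 - 1) := by
    rw [hsq₁, hA₁]
    field_simp
    ring
  have hA₂' : A₂ = δ * (s₂ ^ 2 - 1) := by
    rw [hsq₂, hA₂]
    field_simp
    ring
  have hB₁' : B₁ = s₁ * δ * (1 - ρ / γ₁) := by
    have h : ρ / γ₁ = 1 - δ⁻¹ * (B₁ / s₁) := by rw [div_eq_iff hγ₁.ne', mul_comm]; exact hB₁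
    rw [h]
    field_simp
    ring
  have hB₂' : B₂ = s₂ * δ * (1 - ρ / γ₂) := by
    have h : ρ / γ₂ = 1 - δ⁻¹ * (B₂ / s₂) := by rw [div_eq_iff hγ₂.ne', mul_comm]; exact hB₂
    rw [h]
    field_simp
    ring
  rw [← hsq₁, ← hsq₂]
  rw [hA₁', hA₂', hB₁', hB₂'] at hI
  have hsq : 0 ≤ δ * ρ ^ 2 * (s₁ / γ₁ - s₂ / γ₂) ^ 2
      + δ * ρ / (γ₁ * s₁ * s₂) * (s₁ - s₂) ^ 2 := by positivity
  have hid : (δ * ρ * (s₂ ^ 2 - 1) + δ * ρ ^ 2 * s₂ ^ 2 / γ₂ ^ 2)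
      - (δ * ρ * (s₁ ^ 2 - 1) + δ * ρ ^ 2 * s₁ ^ 2 / γ₁ ^ 2)
      = 2 * ((ρ * s₁ / (2 * γ₁ * s₂) + ρ / 2) * (δ * (s₂ ^ 2 - 1))
          - ρ * s₁ / γ₁ * (s₂ * δ * (1 - ρ / γ₂))
        - ((ρ / 2 + ρ / γ₁ - ρ * s₂ / (2 * γ₁ * s₁)) * (δ * (s₁ ^ 2 - 1))
          - ρ * s₁ / γ₁ * (s₁ * δ * (1 - ρ / γ₁))))
        + (δ * ρ ^ 2 * (s₁ / γ₁ - s₂ / γ₂) ^ 2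
          + δ * ρ / (γ₁ * s₁ * s₂) * (s₁ - s₂) ^ 2) := by
    field_simp
    ring
  linarith

lemma IsSEFixedPoint.mem_Icc {δ ρ a A : ℝ} (hδ : 0 < δ) (ha : 0 ≤ a) (haA : a ≤ A)
    {p : ℝ × ℝ} (hp : IsSEFixedPoint δ ρ a p) :
    p ∈ Set.Icc ((1 : ℝ), ρ) (1 + δ⁻¹ * A ^ 2, ρ + δ⁻¹) := by
  obtain ⟨ht, hγ, hA, -⟩ := (isSEFixedPoint_iff ha _).1 hp
  obtain ⟨-, -, -, hB⟩ := hp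
  have hγ1 : 0 < 1 + p.2 := by linarith
  have hA' : ∫ z, clip a (√p.1 / (1 + p.2) * z) ^ 2 ∂gaussianReal 0 1 ≤ A ^ 2 := by
    have h := integral_mono (integrable_clip_sq a (√p.1 / (1 + p.2)))
      (integrable_const (A ^ 2)) fun z ↦ sq_le_sq.2
        ((abs_clip_le _ _).trans (abs_le_abs_of_nonneg ha haA))
    simpa using h
  have hpos : 0 ≤ ∫ z, eta' a p.2 (√p.1 * z) ∂gaussianReal 0 1 := by
    refine integral_nonneg fun z ↦ ?_
    unfold eta'
    dsimp only
    split_ifs <;> positivity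
  have hle : ∫ z, eta' a p.2 (√p.1 * z) ∂gaussianReal 0 1 ≤ 1 / (1 + p.2) := by
    have h := integral_mono_of_nonneg (μ := gaussianReal 0 1)
      (f := fun z ↦ eta' a p.2 (√p.1 * z)) (g := fun _ ↦ 1 / (1 + p.2))
      (ae_of_all _ fun z ↦ by
        simp only [eta', Pi.zero_apply]
        split_ifs <;> positivity)
      (integrable_const _)
      (ae_of_all _ fun z ↦ by
        simp only [eta']
        split_ifs
        · exact le_rfl
        · positivity)
    simpa using h
  have hB' : ρ = p.2 - p.2 * (δ⁻¹ * ∫ z, eta' a p.2 (√p.1 * z) ∂gaussianReal 0 1) := by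
    rw [mul_sub, mul_one] at hB
    exact hB
  have hub : p.2 * (δ⁻¹ * ∫ z, eta' a p.2 (√p.1 * z) ∂gaussianReal 0 1) ≤ δ⁻¹ := by
    calc _ ≤ p.2 * (δ⁻¹ * (1 / (1 + p.2))) := by gcongr
      _ = δ⁻¹ * (p.2 / (1 + p.2)) := by ring
      _ ≤ δ⁻¹ * 1 := by
        gcongr
        rw [div_le_one hγ1]
        linarith
      _ = δ⁻¹ := mul_one _
  have hlb : 0 ≤ p.2 * (δ⁻¹ * ∫ z, eta' a p.2 (√p.1 * z) ∂gaussianReal 0 1) := by positivity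
  refine ⟨⟨ht, by dsimp only; linarith⟩, ⟨?_, by dsimp only; linarith⟩⟩
  dsimp only
  rw [hA]
  gcongr

open Topology in
/-- The set of solutions of the fixed-point equations has a closed graph. -/
lemma IsSEFixedPoint.of_tendsto {ι : Type*} {l : Filter ι} [l.NeBot] {δ ρ a : ℝ} (hρ : 0 < ρ)
    {u : ι → ℝ} {q : ι → ℝ × ℝ} {p : ℝ × ℝ} (hu : Tendsto u l (𝓝 a)) (hq : Tendsto q l (𝓝 p))
    (hmem : ∀ᶠ i in l, 0 ≤ u i) (hγ : ρ ≤ p.2) (hSE : ∀ᶠ i in l, IsSEFixedPoint δ ρ (u i) (q i)) :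
    IsSEFixedPoint δ ρ a p := by
  have ha : 0 ≤ a := ge_of_tendsto hu hmem
  have hq₁ : Tendsto (fun i ↦ (q i).1) l (𝓝 p.1) := (continuous_fst.tendsto p).comp hq
  have hq₂ : Tendsto (fun i ↦ (q i).2) l (𝓝 p.2) := (continuous_snd.tendsto p).comp hq
  have hpos : 0 < p.2 := hρ.trans_le hγ
  have ht : 1 ≤ p.1 := ge_of_tendsto hq₁ (hSE.mono fun i hi ↦ hi.1)
  have hs : Tendsto (fun i ↦ √(q i).1) l (𝓝 √p.1) := (Real.continuous_sqrt.tendsto _).comp hq₁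
  have hs0 : √p.1 ≠ 0 := (Real.sqrt_pos.2 (by linarith)).ne'
  have hk : Tendsto (fun i ↦ √(q i).1 / (1 + (q i).2)) l (𝓝 (√p.1 / (1 + p.2))) :=
    hs.div (hq₂.const_add 1) (by positivity)
  have huk := hu.prodMk_nhds hk
  have hA := (continuous_integral_clip_sq.tendsto _).comp huk
  have hB := (continuous_integral_id_mul_clip.tendsto _).comp huk
  refine (isSEFixedPoint_iff ha p).2 ⟨ht, hpos, ?_, ?_⟩
  · refine tendsto_nhds_unique_of_eventuallyEq hq₁ ((hA.const_mul δ⁻¹).const_add 1) ?_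
    filter_upwards [hmem, hSE] with i hi hi'
    exact ((isSEFixedPoint_iff hi _).1 hi').2.2.1
  · refine tendsto_nhds_unique_of_eventuallyEq tendsto_const_nhds
      (hq₂.mul (((hB.div hs hs0).const_mul δ⁻¹).const_sub 1)) ?_
    filter_upwards [hmem, hSE] with i hi hi'
    exact ((isSEFixedPoint_iff hi _).1 hi').2.2.2

open Topology in
lemma continuousOn_seFixedPoint {δ ρ : ℝ} (hδ : 0 < δ) (hρ : 0 < ρ) {P : ℝ → ℝ × ℝ}
    (hSE : ∀ a, 0 ≤ a → IsSEFixedPoint δ ρ a (P a))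
    (huniq : ∀ a, 0 ≤ a → ∀ p, IsSEFixedPoint δ ρ a p → p = P a) :
    ContinuousOn P (Set.Ici 0) := by
  intro a ha
  have hmem : ∀ᶠ x in 𝓝[Set.Ici 0] a, (0 : ℝ) ≤ x := self_mem_nhdsWithin
  have hlt : ∀ᶠ x in 𝓝[Set.Ici 0] a, x < a + 1 :=
    mem_nhdsWithin_of_mem_nhds (Iio_mem_nhds (lt_add_one a))
  refine (isCompact_Icc (a := ((1 : ℝ), ρ))
    (b := (1 + δ⁻¹ * (a + 1) ^ 2, ρ + δ⁻¹))).tendsto_nhds_of_unique_mapClusterPt ?_ ?_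
  · filter_upwards [hmem, hlt] with x hx hx'
    exact (hSE x hx).mem_Icc hδ hx hx'.le
  · intro p hp hcl
    obtain ⟨U, hU, hlim⟩ := mapClusterPt_iff_ultrafilter.1 hcl
    exact huniq a ha p (IsSEFixedPoint.of_tendsto hρ
      (tendsto_id.mono_left (hU.trans nhdsWithin_le_nhds)) hlim (hU hmem) hp.1.2
      ((show ∀ᶠ x in (U : Filter ℝ), (0 : ℝ) ≤ x from hU hmem).mono fun x hx ↦ hSE x hx))

lemma continuousOn_seSlope {ρ : ℝ} {P : ℝ → ℝ × ℝ} (hP : ContinuousOn P (Set.Ici 0))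
    (hpos : ∀ a, 0 ≤ a → 0 < (P a).2) :
    ContinuousOn (fun a ↦ seSlope ρ a (P a)) (Set.Ici 0) := by
  have h₁ : ContinuousOn (fun a ↦ (P a).1) (Set.Ici 0) := continuous_fst.comp_continuousOn hP
  have h₂ : ContinuousOn (fun a ↦ (P a).2) (Set.Ici 0) := continuous_snd.comp_continuousOn hP
  have h₃ := continuous_integral_excess.comp_continuousOn
    (h₁.sqrt.prodMk (continuousOn_id.mul (continuousOn_const (c := (1 : ℝ)).add h₂)))
  exact ((continuousOn_const.mul
    (continuousOn_const.div h₂ fun a ha ↦ (hpos a ha).ne')).mul h₃).neg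

lemma convexOn_of_subgradient {s : Set ℝ} {f g : ℝ → ℝ} (hs : Convex ℝ s)
    (h : ∀ x ∈ s, ∀ y ∈ s, f x + g x * (y - x) ≤ f y) : ConvexOn ℝ s f := by
  refine ⟨hs, fun x hx y hy c d hc hd hcd ↦ ?_⟩
  have hz := hs hx hy hc hd hcd
  have h₁ := mul_le_mul_of_nonneg_left (h _ hz x hx) hc
  have h₂ := mul_le_mul_of_nonneg_left (h _ hz y hy) hd
  simp only [smul_eq_mul] at *
  obtain rfl : d = 1 - c := by linarith
  linarith

open Topology Asymptotics in
lemma hasDerivWithinAt_of_continuous_subgradient {s : Set ℝ} {f g : ℝ → ℝ}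
    (h : ∀ x ∈ s, ∀ y ∈ s, f x + g x * (y - x) ≤ f y) {x : ℝ} (hx : x ∈ s)
    (hg : ContinuousWithinAt g s x) : HasDerivWithinAt f (g x) s x := by
  rw [hasDerivWithinAt_iff_isLittleO]
  have hlim : Tendsto (fun y ↦ g y - g x) (𝓝[s] x) (𝓝 0) := by
    simpa using hg.tendsto.sub_const (g x)
  have ho : (fun y ↦ (g y - g x) * (y - x)) =o[𝓝[s] x] fun y ↦ y - x := by
    simpa using ((isLittleO_one_iff ℝ).2 hlim).mul_isBigO
      (isBigO_refl (fun y ↦ y - x) (𝓝[s] x))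
  refine IsBigO.trans_isLittleO (IsBigO.of_bound 1 ?_) ho
  filter_upwards [self_mem_nhdsWithin] with y hy
  have h₁ := h x hx y hy
  have h₂ := h y hy x hx
  rw [one_mul, Real.norm_eq_abs, Real.norm_eq_abs, smul_eq_mul, abs_of_nonneg (by linarith)]
  exact le_trans (by linarith) (le_abs_self _)

/-- Lemma 2, first part. For `δ > 0`, `ρ > 0`, `λ > 0`, the function
`f(a) = δρ(τ_a² − 1) + δρ²τ_a²/γ_a² + λa²` is strongly convex and continuously
differentiable on `[0, ∞)`, where for each `a ≥ 0`, `(τ_a², γ_a)` is the unique solution of the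
state-evolution fixed-point equations. -/
theorem fLim_strongConvexOn_contDiffOn (δ ρ lam : ℝ) (hδ : 0 < δ) (hρ : 0 < ρ) (hlam : 0 < lam)
    (τ2 γv : ℝ → ℝ)
    (hSE : ∀ a, 0 ≤ a → IsSEFixedPoint δ ρ a (τ2 a, γv a))
    (hSEuniq : ∀ a, 0 ≤ a → ∀ p : ℝ × ℝ, IsSEFixedPoint δ ρ a p → p = (τ2 a, γv a)) :
    (∃ m > 0, StrongConvexOn (Set.Ici (0 : ℝ)) m (fLim δ ρ lam τ2 γv)) ∧
      ContDiffOn ℝ 1 (fLim δ ρ lam τ2 γv) (Set.Ici (0 : ℝ)) := by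
  have hsub : ∀ x ∈ Set.Ici (0 : ℝ), ∀ y ∈ Set.Ici (0 : ℝ),
      seValue δ ρ (τ2 x, γv x) + seSlope ρ x (τ2 x, γv x) * (y - x)
        ≤ seValue δ ρ (τ2 y, γv y) :=
    fun x hx y hy ↦ seValue_add_slope_le hδ hρ hx hy (hSE x hx) (hSE y hy)
  have hslope : ContinuousOn (fun a ↦ seSlope ρ a (τ2 a, γv a)) (Set.Ici 0) :=
    continuousOn_seSlope (continuousOn_seFixedPoint hδ hρ hSE hSEuniq) fun a ha ↦ (hSE a ha).2.1
  have hderiv : ∀ a ∈ Set.Ici (0 : ℝ), HasDerivWithinAt (fLim δ ρ lam τ2 γv)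
      (seSlope ρ a (τ2 a, γv a) + lam * (2 * a)) (Set.Ici 0) a := by
    intro a ha
    have h₁ := hasDerivWithinAt_of_continuous_subgradient
      (f := fun a ↦ seValue δ ρ (τ2 a, γv a)) hsub ha (hslope a ha)
    have h₂ : HasDerivWithinAt (fun a : ℝ ↦ lam * a ^ 2) (lam * (2 * a)) (Set.Ici 0) a := by
      simpa using ((hasDerivAt_pow 2 a).const_mul lam).hasDerivWithinAt
    exact h₁.add h₂
  refine ⟨⟨2 * lam, by positivity, strongConvexOn_iff_convex.2 ?_⟩, ?_⟩
  · refine (convexOn_of_subgradient (convex_Ici 0) hsub).congr fun a _ ↦ ?_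
    simp [fLim, seValue]
  · refine (contDiffOn_one_iff_derivWithin (uniqueDiffOn_Ici 0)).2
      ⟨fun a ha ↦ (hderiv a ha).differentiableWithinAt, ?_⟩
    refine ContinuousOn.congr (f := fun a ↦ seSlope ρ a (τ2 a, γv a) + lam * (2 * a))
      (hslope.add (by fun_prop)) fun a ha ↦ ?_
    exact (hderiv a ha).derivWithin (uniqueDiffOn_Ici 0 a ha)
end
end

section
/- Fix δ > 0, ρ > 0 and a ≥ 0, and let (τ_a², γ_a) be the unique solution of the state-evolution fixed-point equations. Define the state-evolution sequence by τ_0² := 1 and τ_{t+1}² := 1 + δ⁻¹·E[η_a(τ_t Z; γ_a)²], where Z is standard Gaussian. Then the sequence (τ_t²)_{t≥0} converges to τ_a², the unique fixed point of the map σ² ↦ 1 + δ⁻¹·E[η_a(σZ; γ_a)²] on [1, ∞). -/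
noncomputable section
open MeasureTheory ProbabilityTheory Filter
open scoped ENNReal NNReal

/-- The state-evolution sequence `τ_0² = 1`, `τ_{t+1}² = 1 + δ⁻¹ E[η_a(τ_t Z; γ)²]`. -/
def seSeq (δ a γ : ℝ) : ℕ → ℝ
  | 0 => 1
  | t + 1 => 1 + δ⁻¹ * ∫ z, (eta a γ (Real.sqrt (seSeq δ a γ t) * z)) ^ 2 ∂stdGaussian

/-- The squared denoiser is a capped square. -/
lemma eta_sq_eq_min {a : ℝ} (ha : 0 ≤ a) (γ x : ℝ) :
    eta a γ x ^ 2 = min (a ^ 2) ((x / (1 + γ)) ^ 2) := by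
  unfold eta
  generalize x / (1 + γ) = y
  rcases le_total y (-a) with h | h
  · rw [min_eq_right (by linarith), max_eq_left h, min_eq_left (by nlinarith)]
    ring
  · rcases le_total a y with h' | h'
    · rw [min_eq_left h', max_eq_right (by linarith), min_eq_left (by nlinarith)]
    · rw [min_eq_right h', max_eq_right h, min_eq_right (by nlinarith)]

lemma eta_sqrt_mul_sq {a s : ℝ} (ha : 0 ≤ a) (hs : 0 ≤ s) (γ z : ℝ) :
    eta a γ (Real.sqrt s * z) ^ 2 = min (a ^ 2) (s * (z / (1 + γ)) ^ 2) := by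
  rw [eta_sq_eq_min ha, mul_div_assoc, mul_pow, Real.sq_sqrt hs]

lemma integrable_eta_sq {a : ℝ} (ha : 0 ≤ a) (γ c : ℝ) :
    Integrable (fun z => eta a γ (c * z) ^ 2) stdGaussian := by
  have : IsProbabilityMeasure stdGaussian := by unfold _root_.stdGaussian; infer_instance
  refine Integrable.of_bound (C := a ^ 2) ?_ (ae_of_all _ fun z => ?_)
  · unfold eta
    fun_prop
  · rw [Real.norm_of_nonneg (sq_nonneg _), eta_sq_eq_min ha]
    exact min_le_left _ _

lemma integral_eta_sq_mono {a s t : ℝ} (ha : 0 ≤ a) (γ : ℝ) (hs : 0 ≤ s) (hst : s ≤ t) :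
    ∫ z, eta a γ (Real.sqrt s * z) ^ 2 ∂stdGaussian ≤
      ∫ z, eta a γ (Real.sqrt t * z) ^ 2 ∂stdGaussian := by
  refine integral_mono (integrable_eta_sq ha γ _) (integrable_eta_sq ha γ _) fun z => ?_
  simp only [eta_sqrt_mul_sq ha hs, eta_sqrt_mul_sq ha (hs.trans hst)]
  gcongr

/-- The second moment of the denoiser output, as a function of the variance, lies above its
chords through the origin (it is concave and vanishes at `0`). -/
lemma div_mul_integral_eta_sq_le {a s t : ℝ} (ha : 0 ≤ a) (γ : ℝ) (hs : 0 ≤ s) (ht : 0 < t)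
    (hst : s ≤ t) :
    s / t * ∫ z, eta a γ (Real.sqrt t * z) ^ 2 ∂stdGaussian ≤
      ∫ z, eta a γ (Real.sqrt s * z) ^ 2 ∂stdGaussian := by
  rw [← integral_const_mul]
  refine integral_mono ((integrable_eta_sq ha γ _).const_mul _) (integrable_eta_sq ha γ _)
    fun z => ?_
  simp only [eta_sqrt_mul_sq ha hs, eta_sqrt_mul_sq ha ht.le]
  have h0 : 0 ≤ s / t := by positivity
  have h1 : s / t ≤ 1 := (div_le_one ht).2 hst
  refine le_min ?_ ?_
  · calc s / t * min (a ^ 2) (t * (z / (1 + γ)) ^ 2) ≤ s / t * a ^ 2 := by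
          gcongr
          exact min_le_left _ _
      _ ≤ a ^ 2 := mul_le_of_le_one_left (sq_nonneg a) h1
  · calc s / t * min (a ^ 2) (t * (z / (1 + γ)) ^ 2) ≤ s / t * (t * (z / (1 + γ)) ^ 2) := by
          gcongr
          exact min_le_right _ _
      _ = s * (z / (1 + γ)) ^ 2 := by field_simp

/-- Below a fixed point `t`, one step of the state-evolution map contracts the distance to `t`
by the factor `1 - 1 / t`. -/
lemma sub_seMap_le {δ a γ s t : ℝ} (hδ : 0 < δ) (ha : 0 ≤ a) (hs : 0 ≤ s) (ht : 0 < t)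
    (hst : s ≤ t)
    (hfix : t = 1 + δ⁻¹ * ∫ z, (eta a γ (Real.sqrt t * z)) ^ 2 ∂stdGaussian) :
    t - (1 + δ⁻¹ * ∫ z, (eta a γ (Real.sqrt s * z)) ^ 2 ∂stdGaussian) ≤
      (1 - 1 / t) * (t - s) := by
  have h := mul_le_mul_of_nonneg_left (div_mul_integral_eta_sq_le ha γ hs ht hst)
    (inv_nonneg.2 hδ.le)
  have h2 : δ⁻¹ * (s / t * ∫ z, eta a γ (Real.sqrt t * z) ^ 2 ∂stdGaussian) =
      s / t * (t - 1) := by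
    linear_combination (-(s / t)) * hfix
  have h3 : (1 - 1 / t) * (t - s) = t - 1 - s / t * (t - 1) := by
    field_simp
  linarith

lemma lt_seMap_of_lt_fixedPoint {δ a γ s t : ℝ} (hδ : 0 < δ) (ha : 0 ≤ a) (hs : 0 ≤ s)
    (hst : s < t)
    (hfix : t = 1 + δ⁻¹ * ∫ z, (eta a γ (Real.sqrt t * z)) ^ 2 ∂stdGaussian) :
    s < 1 + δ⁻¹ * ∫ z, (eta a γ (Real.sqrt s * z)) ^ 2 ∂stdGaussian := by
  have ht : 0 < t := hs.trans_lt hst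
  have h := sub_seMap_le hδ ha hs ht hst.le hfix
  have h1 : 0 < 1 / t * (t - s) := mul_pos (by positivity) (sub_pos.2 hst)
  linarith

lemma one_le_seSeq {δ : ℝ} (hδ : 0 < δ) (a γ : ℝ) (n : ℕ) : 1 ≤ seSeq δ a γ n := by
  cases n with
  | zero => exact le_rfl
  | succ n =>
    have h : 0 ≤ ∫ z, (eta a γ (Real.sqrt (seSeq δ a γ n) * z)) ^ 2 ∂stdGaussian :=
      integral_nonneg fun z => sq_nonneg _
    have := mul_nonneg (inv_nonneg.2 hδ.le) h
    simpa [seSeq] using this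

lemma seSeq_le_fixedPoint {δ a γ t : ℝ} (hδ : 0 < δ) (ha : 0 ≤ a) (ht : 1 ≤ t)
    (hfix : t = 1 + δ⁻¹ * ∫ z, (eta a γ (Real.sqrt t * z)) ^ 2 ∂stdGaussian) (n : ℕ) :
    seSeq δ a γ n ≤ t := by
  induction n with
  | zero => exact ht
  | succ n ih =>
    have h := mul_le_mul_of_nonneg_left
      (integral_eta_sq_mono ha γ (by linarith [one_le_seSeq hδ a γ n]) ih) (inv_nonneg.2 hδ.le)
    rw [seSeq]
    linarith

lemma sub_seSeq_le_pow {δ a γ t : ℝ} (hδ : 0 < δ) (ha : 0 ≤ a) (ht : 1 ≤ t)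
    (hfix : t = 1 + δ⁻¹ * ∫ z, (eta a γ (Real.sqrt t * z)) ^ 2 ∂stdGaussian) (n : ℕ) :
    t - seSeq δ a γ n ≤ (1 - 1 / t) ^ n * (t - 1) := by
  induction n with
  | zero => simp [seSeq]
  | succ n ih =>
    have hr : 0 ≤ 1 - 1 / t := sub_nonneg.2 ((div_le_one (by linarith)).2 ht)
    calc t - seSeq δ a γ (n + 1) ≤ (1 - 1 / t) * (t - seSeq δ a γ n) := by
          rw [seSeq]
          exact sub_seMap_le hδ ha (by linarith [one_le_seSeq hδ a γ n]) (by linarith)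
            (seSeq_le_fixedPoint hδ ha ht hfix n) hfix
      _ ≤ (1 - 1 / t) * ((1 - 1 / t) ^ n * (t - 1)) := by gcongr
      _ = (1 - 1 / t) ^ (n + 1) * (t - 1) := by ring

/-- The state-evolution sequence converges geometrically to any fixed point in `[1, ∞)`. -/
lemma tendsto_seSeq {δ a γ t : ℝ} (hδ : 0 < δ) (ha : 0 ≤ a) (ht : 1 ≤ t)
    (hfix : t = 1 + δ⁻¹ * ∫ z, (eta a γ (Real.sqrt t * z)) ^ 2 ∂stdGaussian) :
    Tendsto (seSeq δ a γ) atTop (nhds t) := by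
  have hr : 0 ≤ 1 - 1 / t := sub_nonneg.2 ((div_le_one (by linarith)).2 ht)
  have hr1 : 1 - 1 / t < 1 := sub_lt_self _ (by positivity)
  have hlim : Tendsto (fun n : ℕ => t - (1 - 1 / t) ^ n * (t - 1)) atTop (nhds t) := by
    simpa using ((tendsto_pow_atTop_nhds_zero_of_lt_one hr hr1).mul_const (t - 1)).const_sub t
  refine tendsto_of_tendsto_of_tendsto_of_le_of_le hlim tendsto_const_nhds (fun n => ?_)
    (seSeq_le_fixedPoint hδ ha ht hfix)
  have := sub_seSeq_le_pow hδ ha ht hfix n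
  simp only
  linarith

/-- For `δ > 0`, `ρ > 0` and `a ≥ 0`, the state-evolution sequence
`τ_0² = 1`, `τ_{t+1}² = 1 + δ⁻¹ E[η_a(τ_t Z; γ_a)²]` converges to `τ_a²`, the unique fixed
point of `σ² ↦ 1 + δ⁻¹ E[η_a(σZ; γ_a)²]` on `[1, ∞)`. -/
theorem se_sequence_converges
    (δ ρ a : ℝ) (hδ : 0 < δ) (hρ : 0 < ρ) (ha : 0 ≤ a) (τ2a γa : ℝ)
    (hSE : IsSEFixedPoint δ ρ a (τ2a, γa))
    (hSEuniq : ∀ p : ℝ × ℝ, IsSEFixedPoint δ ρ a p → p = (τ2a, γa)) :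
    Filter.Tendsto (seSeq δ a γa) Filter.atTop (nhds τ2a) ∧
      ∀ σ2 : ℝ, 1 ≤ σ2 →
        σ2 = 1 + δ⁻¹ * ∫ z, (eta a γa (Real.sqrt σ2 * z)) ^ 2 ∂stdGaussian → σ2 = τ2a := by
  obtain ⟨hτ, -, hfix, -⟩ := hSE
  refine ⟨tendsto_seSeq hδ ha hτ hfix, fun σ2 hσ hσfix => ?_⟩
  rcases lt_trichotomy σ2 τ2a with h | h | h
  · exact absurd hσfix (lt_seMap_of_lt_fixedPoint hδ ha (by linarith) h hfix).ne
  · exact h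
  · exact absurd hfix (lt_seMap_of_lt_fixedPoint hδ ha (by linarith) h hσfix).ne
end
end
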